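/- Let γ > 0 and c > 0, and suppose that for all u ∈ C_c^∞(ℝ^d): ( ∫_{ℝ^d} u² dμ )^{1 + 1/γ} ≤ c·D(u,u)·( ∫_{ℝ^d} |u(x)|·(1 + |x|)^{α−d} μ(dx) )^{2/γ}. Then γ ≥ (d + β − 2α)/(β − α). -/

import Mathlib

open MeasureTheory

/-- The fractional Dirichlet energy
`D(f,f) = ∫∫ (f(x) − f(y))² / |x − y|^{d+α} dx dy` on `ℝ^d`. -/
noncomputable def fracD (d : ℕ) (α : ℝ) (f : EuclideanSpace ℝ (Fin d) → ℝ) : ℝ :=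
  ∫ x, ∫ y, (f x - f y) ^ 2 / ‖x - y‖ ^ ((d : ℝ) + α)

theorem exists_annulus_bump (d : ℕ) (hd : 0 < d) :
    ∃ φ : EuclideanSpace ℝ (Fin d) → ℝ, ContDiff ℝ (⊤ : ℕ∞) φ ∧ HasCompactSupport φ ∧
      (∀ x, φ x ≠ 0 → 1 ≤ ‖x‖ ∧ ‖x‖ ≤ 3) ∧ 0 < ∫ x, (φ x) ^ 2 := by
  let e : EuclideanSpace ℝ (Fin d) := EuclideanSpace.single ⟨0, hd⟩ 2
  have he : ‖e‖ = 2 := by simp [e]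
  let b : ContDiffBump e := ⟨1/2, 1, by norm_num, by norm_num⟩
  refine ⟨b, b.contDiff, b.hasCompactSupport, ?_, ?_⟩
  · intro x hx
    have hx' : x ∈ Function.support b := hx
    rw [b.support_eq, Metric.mem_ball, dist_eq_norm] at hx'
    have h1 : ‖x - e‖ < 1 := hx'
    have h2 : ‖e‖ ≤ ‖x‖ + ‖x - e‖ := by
      have := norm_sub_le x (x - e)
      simpa using this
    have h3 : ‖x‖ ≤ ‖e‖ + ‖x - e‖ := by
      have := norm_add_le e (x - e)
      simpa using this
    constructor <;> linarith
  · have hcont : Continuous fun x => (b x) ^ 2 := b.continuous.pow 2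
    refine hcont.integral_pos_of_hasCompactSupport_nonneg_nonzero ?_ (fun x => by positivity) (x := e) ?_
    · exact b.hasCompactSupport.comp_left (g := fun t : ℝ => t ^ 2) (by simp)
    · have : b e = 1 := b.one_of_mem_closedBall (by simp [b])
      simp [this]

theorem fracD_scale (d : ℕ) (α : ℝ) (φ : EuclideanSpace ℝ (Fin d) → ℝ) (R : ℝ) (hR : 0 < R) :
    fracD d α (fun x => φ (R⁻¹ • x)) = R ^ ((d : ℝ) - α) * fracD d α φ := by
  have key : ∀ x y : EuclideanSpace ℝ (Fin d),
      (φ (R⁻¹ • x) - φ (R⁻¹ • y)) ^ 2 / ‖x - y‖ ^ ((d : ℝ) + α) =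
      R ^ (-((d : ℝ) + α)) * ((φ (R⁻¹ • x) - φ (R⁻¹ • y)) ^ 2 /
        ‖R⁻¹ • x - R⁻¹ • y‖ ^ ((d : ℝ) + α)) := by
    intro x y
    rw [← smul_sub, norm_smul, Real.norm_of_nonneg (inv_nonneg.2 hR.le),
      Real.mul_rpow (inv_nonneg.2 hR.le) (norm_nonneg _), Real.inv_rpow hR.le,
      Real.rpow_neg hR.le]
    have : R ^ ((d : ℝ) + α) ≠ 0 := (Real.rpow_pos_of_pos hR _).ne'
    rw [div_mul_eq_div_div, div_inv_eq_mul]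
    field_simp
  unfold fracD
  have h1 : ∀ x : EuclideanSpace ℝ (Fin d),
      (∫ y, (φ (R⁻¹ • x) - φ (R⁻¹ • y)) ^ 2 / ‖x - y‖ ^ ((d : ℝ) + α)) =
      R ^ (-((d : ℝ) + α)) * (R ^ d * ∫ y, (φ (R⁻¹ • x) - φ y) ^ 2 /
        ‖R⁻¹ • x - y‖ ^ ((d : ℝ) + α)) := by
    intro x
    simp_rw [key x]
    rw [integral_const_mul]
    have := Measure.integral_comp_inv_smul_of_nonneg (volume : Measure (EuclideanSpace ℝ (Fin d)))
      (fun y => (φ (R⁻¹ • x) - φ y) ^ 2 / ‖R⁻¹ • x - y‖ ^ ((d : ℝ) + α)) hR.le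
    rw [this]
    simp
  simp_rw [h1]
  rw [integral_const_mul, integral_const_mul]
  have := Measure.integral_comp_inv_smul_of_nonneg (volume : Measure (EuclideanSpace ℝ (Fin d)))
      (fun x => ∫ y, (φ x - φ y) ^ 2 / ‖x - y‖ ^ ((d : ℝ) + α)) hR.le
  rw [this]
  simp only [finrank_euclideanSpace, Fintype.card_fin, smul_eq_mul]
  have e : R ^ ((d : ℝ) - α) = R ^ (-((d : ℝ) + α)) * (R ^ d * R ^ d) := by
    rw [← Real.rpow_natCast, ← Real.rpow_add hR, ← Real.rpow_add hR]
    congr 1; ring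
  rw [e]; ring

theorem exponent_le (p q A B : ℝ) (hA : 0 < A)
    (h : ∀ R : ℝ, 1 ≤ R → A * R ^ p ≤ B * R ^ q) : p ≤ q := by
  by_contra! hlt
  have ht := tendsto_rpow_atTop (sub_pos.2 hlt)
  obtain ⟨R, hR1, hR2⟩ := ((ht.eventually_gt_atTop (B / A)).and
    (Filter.eventually_ge_atTop 1)).exists
  have hR : 0 < R := by linarith
  have h1 := h R hR2
  rw [Real.rpow_sub hR, div_lt_div_iff₀ hA (Real.rpow_pos_of_pos hR _)] at hR1
  linarith

theorem nash_rate_optimality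
    (d : ℕ) (α β : ℝ) (hα : α ∈ Set.Ioo (0 : ℝ) 2) (hd : α < d)
    (hβ₁ : α < β) (hβ₂ : β < 2 * α)
    (γ c : ℝ) (hγ : 0 < γ) (hc : 0 < c)
    (hNash : ∀ u : EuclideanSpace ℝ (Fin d) → ℝ,
      ContDiff ℝ (⊤ : ℕ∞) u → HasCompactSupport u →
        (∫ x, (u x) ^ 2 * (1 + ‖x‖) ^ (-β)) ^ (1 + 1 / γ) ≤
          c * fracD d α u *
            (∫ x, |u x| * (1 + ‖x‖) ^ (α - (d : ℝ)) * (1 + ‖x‖) ^ (-β))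
              ^ (2 / γ)) :
    ((d : ℝ) + β - 2 * α) / (β - α) ≤ γ := by
  obtain ⟨hα0, -⟩ := hα
  have hd0 : 0 < d := by
    have : (0 : ℝ) < d := hα0.trans hd
    exact_mod_cast this
  obtain ⟨φ, hφ, hφc, hφs, hφi⟩ := exists_annulus_bump d hd0
  set I := ∫ x, (φ x) ^ 2 with hI
  set J := ∫ x, |φ x| with hJ
  have hJ0 : 0 ≤ J := integral_nonneg fun x => abs_nonneg _
  have hcontw : ∀ (R s : ℝ), 0 ≤ R →
      Continuous fun x : EuclideanSpace ℝ (Fin d) => (1 + R * ‖x‖) ^ s := by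
    intro R s hR
    refine Continuous.rpow_const (by fun_prop) fun x => Or.inl ?_
    have : 0 ≤ R * ‖x‖ := by positivity
    linarith
  have hsq : HasCompactSupport fun x => (φ x) ^ 2 :=
    hφc.comp_left (g := fun t : ℝ => t ^ 2) (by simp)
  have habs : HasCompactSupport fun x => |φ x| :=
    hφc.comp_left (g := fun t : ℝ => |t|) (by simp)
  have hφcont := hφ.continuous
  have main : ∀ R : ℝ, 1 ≤ R →
      (4 ^ (-β) * I) ^ (1 + 1 / γ) * R ^ (((d : ℝ) - β) * (1 + 1 / γ)) ≤
      (c * fracD d α φ * J ^ (2 / γ)) * R ^ ((d : ℝ) - α + (α - β) * (2 / γ)) := by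
    intro R hR1
    have hR : 0 < R := by linarith
    have hN := hNash (fun x => φ (R⁻¹ • x)) (hφ.comp (contDiff_const_smul _))
      (hφc.comp_smul (inv_ne_zero hR.ne'))
    rw [fracD_scale d α φ R hR] at hN
    have hnorm : ∀ x : EuclideanSpace ℝ (Fin d), ‖x‖ = R * ‖R⁻¹ • x‖ := by
      intro x
      rw [norm_smul, Real.norm_of_nonneg (inv_nonneg.2 hR.le)]
      field_simp
    have hA : (4 ^ (-β) * I) * R ^ ((d : ℝ) - β) ≤
        ∫ x, (φ (R⁻¹ • x)) ^ 2 * (1 + ‖x‖) ^ (-β) := by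
      have e := Measure.integral_comp_inv_smul_of_nonneg
        (volume : Measure (EuclideanSpace ℝ (Fin d)))
        (fun y => (φ y) ^ 2 * (1 + R * ‖y‖) ^ (-β)) hR.le
      simp only [← hnorm] at e
      rw [e]
      simp only [finrank_euclideanSpace, Fintype.card_fin, smul_eq_mul]
      have h2 : I * (4 * R) ^ (-β) ≤ ∫ y, (φ y) ^ 2 * (1 + R * ‖y‖) ^ (-β) := by
        rw [hI, ← integral_mul_const]
        refine integral_mono ?_ ?_ ?_
        · exact ((hφcont.pow 2).integrable_of_hasCompactSupport hsq).mul_const _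
        · exact ((hφcont.pow 2).mul (hcontw R _ hR.le)).integrable_of_hasCompactSupport
            (hsq.mul_right)
        · intro y
          by_cases hy : φ y = 0
          · simp [hy]
          · have := (hφs y hy).2
            refine mul_le_mul_of_nonneg_left ?_ (sq_nonneg _)
            refine Real.rpow_le_rpow_of_nonpos (by positivity) ?_ (by linarith)
            nlinarith
      calc (4 ^ (-β) * I) * R ^ ((d : ℝ) - β) = R ^ d * (I * (4 * R) ^ (-β)) := by
            rw [Real.mul_rpow (by norm_num) hR.le, sub_eq_add_neg, Real.rpow_add hR,
              Real.rpow_natCast]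
            ring
        _ ≤ _ := by gcongr
    have hB : (∫ x, |φ (R⁻¹ • x)| * (1 + ‖x‖) ^ (α - (d : ℝ)) * (1 + ‖x‖) ^ (-β)) ≤
        J * R ^ (α - β) := by
      have e := Measure.integral_comp_inv_smul_of_nonneg
        (volume : Measure (EuclideanSpace ℝ (Fin d)))
        (fun y => |φ y| * (1 + R * ‖y‖) ^ (α - (d : ℝ)) * (1 + R * ‖y‖) ^ (-β)) hR.le
      simp only [← hnorm] at e
      rw [e]
      simp only [finrank_euclideanSpace, Fintype.card_fin, smul_eq_mul]
      have h2 : (∫ y, |φ y| * (1 + R * ‖y‖) ^ (α - (d : ℝ)) * (1 + R * ‖y‖) ^ (-β)) ≤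
          J * (R ^ (α - (d : ℝ)) * R ^ (-β)) := by
        rw [hJ, ← integral_mul_const]
        refine integral_mono ?_ ?_ ?_
        · exact ((hφcont.abs.mul (hcontw R _ hR.le)).mul
            (hcontw R _ hR.le)).integrable_of_hasCompactSupport (habs.mul_right.mul_right)
        · exact (hφcont.abs.integrable_of_hasCompactSupport habs).mul_const _
        · intro y
          by_cases hy : φ y = 0
          · simp [hy]
          · have := (hφs y hy).1
            have hle : R ≤ 1 + R * ‖y‖ := by nlinarith
            have h3 : (1 + R * ‖y‖) ^ (α - (d : ℝ)) ≤ R ^ (α - (d : ℝ)) :=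
              Real.rpow_le_rpow_of_nonpos hR hle (by linarith)
            have h4 : (1 + R * ‖y‖) ^ (-β) ≤ R ^ (-β) :=
              Real.rpow_le_rpow_of_nonpos hR hle (by linarith)
            have h5 : 0 ≤ 1 + R * ‖y‖ := by positivity
            simp only [mul_assoc]
            gcongr
      calc _ ≤ R ^ d * (J * (R ^ (α - (d : ℝ)) * R ^ (-β))) := by gcongr
        _ = J * (R ^ (d : ℝ) * (R ^ (α - (d : ℝ)) * R ^ (-β))) := by
            rw [Real.rpow_natCast]; ring
        _ = J * R ^ (α - β) := by
            rw [← Real.rpow_add hR, ← Real.rpow_add hR]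
            congr 2; ring
    have hD0 : 0 ≤ fracD d α φ := by
      unfold fracD
      exact integral_nonneg fun x => integral_nonneg fun y => by positivity
    have hB0 : 0 ≤ ∫ x, |φ (R⁻¹ • x)| * (1 + ‖x‖) ^ (α - (d : ℝ)) * (1 + ‖x‖) ^ (-β) :=
      integral_nonneg fun x => by positivity
    calc _ = ((4 ^ (-β) * I) * R ^ ((d : ℝ) - β)) ^ (1 + 1 / γ) := by
          rw [Real.mul_rpow (x := 4 ^ (-β) * I) (y := R ^ ((d : ℝ) - β)) (by positivity)
            (by positivity), Real.rpow_mul hR.le]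
      _ ≤ (∫ x, (φ (R⁻¹ • x)) ^ 2 * (1 + ‖x‖) ^ (-β)) ^ (1 + 1 / γ) := by gcongr
      _ ≤ _ := hN
      _ ≤ c * (R ^ ((d : ℝ) - α) * fracD d α φ) * (J * R ^ (α - β)) ^ (2 / γ) := by gcongr
      _ = _ := by
          rw [Real.mul_rpow hJ0 (by positivity), Real.rpow_add hR, Real.rpow_mul hR.le]
          ring
  have hle := exponent_le _ _ _ _ (by positivity) main
  rw [div_le_iff₀ (by linarith)]
  have h2 : ((d : ℝ) - β) * (1 + 1 / γ) * γ ≤ ((d : ℝ) - α + (α - β) * (2 / γ)) * γ :=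
    mul_le_mul_of_nonneg_right hle hγ.le
  have h3 : ((d : ℝ) - β) * (1 + 1 / γ) * γ = (d - β) * (γ + 1) := by field_simp
  have h4 : ((d : ℝ) - α + (α - β) * (2 / γ)) * γ = (d - α) * γ + (α - β) * 2 := by field_simp
  rw [h3, h4] at h2
  linarith
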